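/- arXiv:1411.1905 — 3 statements merged into one kernel-verified Lean document; each statement's English description precedes it below -/
import Mathlib

section
/- There exists a constant C (depending only on dimension) such that for every cube Q in R^n, every b in BMO(R^n) and every f for which ||f||_{L(log L),Q} is finite: |Q|^{-1} int_Q |b(y) - b_Q| |f(y)| dy <= C ||b||_{BMO} ||f||_{L(log L),Q}. -/
open MeasureTheory ENNReal Set

noncomputable section

/-- Euclidean space `ℝⁿ`. -/
abbrev Rn (n : ℕ) := EuclideanSpace ℝ (Fin n)

/-- An axis-parallel cube in `ℝⁿ`, given by its center and (positive) side length. -/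
structure Cube (n : ℕ) where
  center : Rn n
  side : ℝ
  side_pos : 0 < side

namespace Cube

variable {n : ℕ}

/-- The set of points of a cube. -/
def toSet (Q : Cube n) : Set (Rn n) := {y | ∀ i, |y i - Q.center i| ≤ Q.side / 2}

/-- The volume `|Q| = ℓ(Q)ⁿ` of a cube. -/
def vol (Q : Cube n) : ℝ := Q.side ^ n

/-- The dilate `2^k Q`: same center, side length `2^k ℓ(Q)`. -/
def dilate (Q : Cube n) (k : ℕ) : Cube n := ⟨Q.center, 2 ^ k * Q.side, by have := Q.side_pos; positivity⟩

end Cube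

instance {n : ℕ} : Nonempty (Cube n) := ⟨⟨0, 1, one_pos⟩⟩

variable {n : ℕ}

/-- Average of a real function over a cube. -/
def cubeAvg (Q : Cube n) (f : Rn n → ℝ) : ℝ := (Q.vol)⁻¹ * ∫ y in Q.toSet, f y

/-- Mean oscillation of `b` over cube `Q`. -/
def bmoDev (Q : Cube n) (b : Rn n → ℝ) : ℝ :=
  cubeAvg Q (fun y => |b y - cubeAvg Q b|)

/-- The BMO seminorm. -/
def bmoNorm (b : Rn n → ℝ) : ℝ := ⨆ Q : Cube n, bmoDev Q b

/-- Membership in BMO(ℝⁿ). -/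
def MemBMO (b : Rn n → ℝ) : Prop :=
  LocallyIntegrable b volume ∧ BddAbove (Set.range fun Q : Cube n => bmoDev Q b)

/-- Membership in CMO(ℝⁿ): the closure of `C_c^∞` in the BMO norm. -/
def MemCMO (b : Rn n → ℝ) : Prop :=
  MemBMO b ∧ ∀ ε : ℝ, 0 < ε → ∃ g : Rn n → ℝ, ContDiff ℝ (⊤ : ℕ∞) g ∧ HasCompactSupport g ∧
    ∀ Q : Cube n, bmoDev Q (fun y => b y - g y) ≤ ε

/-- The conjugate exponent `p' = p/(p-1)`. -/
def conjExp (p : ℝ) : ℝ := p / (p - 1)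

/-- The Muckenhoupt `A_p` condition for a weight `w`. -/
def IsAp (p : ℝ) (w : Rn n → ℝ) : Prop :=
  (∀ x, 0 ≤ w x) ∧ LocallyIntegrable w volume ∧
  ∃ C : ℝ, ∀ Q : Cube n,
    cubeAvg Q w * (cubeAvg Q (fun y => w y ^ (1 - conjExp p))) ^ (p - 1) ≤ C

/-- The weight `ν_{w⃗} = w₁^{p/p₁} w₂^{p/p₂}`. -/
def nuW (p p1 p2 : ℝ) (w1 w2 : Rn n → ℝ) : Rn n → ℝ :=
  fun x => w1 x ^ (p / p1) * w2 x ^ (p / p2)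

/-- The multilinear `A_{p⃗}` condition for the pair of weights `(w₁, w₂)`. -/
def IsApVec (p p1 p2 : ℝ) (w1 w2 : Rn n → ℝ) : Prop :=
  (∀ x, 0 ≤ w1 x) ∧ (∀ x, 0 ≤ w2 x) ∧
  LocallyIntegrable w1 volume ∧ LocallyIntegrable w2 volume ∧
  ∃ C : ℝ, ∀ Q : Cube n,
    (cubeAvg Q (nuW p p1 p2 w1 w2)) ^ (1 / p) *
    (cubeAvg Q (fun y => w1 y ^ (1 - conjExp p1))) ^ (1 / conjExp p1) *
    (cubeAvg Q (fun y => w2 y ^ (1 - conjExp p2))) ^ (1 / conjExp p2) ≤ C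

/-- The condition `R_θ`: `w(E)/w(Q) ≤ C (|E|/|Q|)^θ`. -/
def MemRtheta (θ : ℝ) (w : Rn n → ℝ) : Prop :=
  ∃ C : ℝ, 0 < C ∧ ∀ Q : Cube n, ∀ E ⊆ Q.toSet, MeasurableSet E →
    ∫⁻ x in E, ENNReal.ofReal (w x) ≤
      ENNReal.ofReal C * (volume E / ENNReal.ofReal Q.vol) ^ θ *
        ∫⁻ x in Q.toSet, ENNReal.ofReal (w x)

/-- Weighted `L^p(w)` norm of a real function, valued in `ℝ≥0∞`. -/
def wLp (p : ℝ) (w : Rn n → ℝ) (f : Rn n → ℝ) : ℝ≥0∞ :=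
  (∫⁻ x, ENNReal.ofReal |f x| ^ p * ENNReal.ofReal (w x)) ^ (1 / p)

/-- Weighted `L^p(w)` norm of an `ℝ≥0∞`-valued function. -/
def wLpE (p : ℝ) (w : Rn n → ℝ) (g : Rn n → ℝ≥0∞) : ℝ≥0∞ :=
  (∫⁻ x, g x ^ p * ENNReal.ofReal (w x)) ^ (1 / p)

/-- `ℝ≥0∞`-valued average of `|f|` over a cube. -/
def avgE (Q : Cube n) (f : Rn n → ℝ) : ℝ≥0∞ :=
  (ENNReal.ofReal Q.vol)⁻¹ * ∫⁻ y in Q.toSet, ENNReal.ofReal |f y|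

/-- `ℝ≥0∞`-valued average of an `ℝ≥0∞`-valued function over a cube. -/
def avgE' (Q : Cube n) (g : Rn n → ℝ≥0∞) : ℝ≥0∞ :=
  (ENNReal.ofReal Q.vol)⁻¹ * ∫⁻ y in Q.toSet, g y

/-- The bilinear maximal function `𝓜(f₁,f₂)`. -/
def MM (f1 f2 : Rn n → ℝ) (x : Rn n) : ℝ≥0∞ :=
  ⨆ (Q : Cube n) (_ : x ∈ Q.toSet), avgE Q f1 * avgE Q f2

/-- The bilinear maximal operator `𝓜_{2,1}` of Grafakos–Liu–Yang. -/
def M21 (f1 f2 : Rn n → ℝ) (x : Rn n) : ℝ≥0∞ :=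
  ⨆ (Q : Cube n) (_ : x ∈ Q.toSet),
    ∑' k : ℕ, ENNReal.ofReal ((2:ℝ) ^ (-((k : ℝ) * n))) * avgE Q f1 * avgE (Q.dilate k) f2

/-- The bilinear maximal operator `𝓜_{2,2}`. -/
def M22 (f1 f2 : Rn n → ℝ) (x : Rn n) : ℝ≥0∞ :=
  ⨆ (Q : Cube n) (_ : x ∈ Q.toSet),
    ∑' k : ℕ, ENNReal.ofReal ((2:ℝ) ^ (-((k : ℝ) * n))) * avgE Q f2 * avgE (Q.dilate k) f1

/-- Hu's bilinear maximal operator `𝓜¹_β`, with sum over `k ≥ 1`. -/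
def M1beta (β : ℝ) (f1 f2 : Rn n → ℝ) (x : Rn n) : ℝ≥0∞ :=
  ⨆ (Q : Cube n) (_ : x ∈ Q.toSet),
    avgE Q f1 * ∑' k : ℕ,
      ENNReal.ofReal ((2:ℝ) ^ (((k : ℝ) + 1) * (β - n))) * avgE (Q.dilate (k + 1)) f2

/-- Hu's bilinear maximal operator `𝓜²_β`, with sum over `k ≥ 1`. -/
def M2beta (β : ℝ) (f1 f2 : Rn n → ℝ) (x : Rn n) : ℝ≥0∞ :=
  ⨆ (Q : Cube n) (_ : x ∈ Q.toSet),
    avgE Q f2 * ∑' k : ℕ,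
      ENNReal.ofReal ((2:ℝ) ^ (((k : ℝ) + 1) * (β - n))) * avgE (Q.dilate (k + 1)) f1

/-- The maximal operator `M_δ f = M(|f|^δ)^{1/δ}` (Hardy–Littlewood for `δ = 1`). -/
def Mdelta (δ : ℝ) (f : Rn n → ℝ) (x : Rn n) : ℝ≥0∞ :=
  (⨆ (Q : Cube n) (_ : x ∈ Q.toSet),
    avgE' Q (fun y => ENNReal.ofReal |f y| ^ δ)) ^ (1 / δ)

/-- The Fefferman–Stein sharp maximal operator `M^{♯}_δ f = M^{♯}(|f|^δ)^{1/δ}`. -/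
def sharpDelta (δ : ℝ) (f : Rn n → ℝ) (x : Rn n) : ℝ≥0∞ :=
  (⨆ (Q : Cube n) (_ : x ∈ Q.toSet),
    ⨅ c : ℝ, avgE' Q (fun y => ENNReal.ofReal |(|f y| ^ δ) - c|)) ^ (1 / δ)

/-- `Φ(t) = t (1 + log⁺ t)`. -/
def PhiLL (t : ℝ) : ℝ := t * (1 + max (Real.log t) 0)

/-- The `L(log L)` Luxemburg norm of `f` over the cube `Q`. -/
def llogNorm (Q : Cube n) (f : Rn n → ℝ) : ℝ :=
  sInf {lam : ℝ | 0 < lam ∧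
    ∫⁻ y in Q.toSet, ENNReal.ofReal (PhiLL (|f y| / lam)) ≤ ENNReal.ofReal Q.vol}

/-- The bilinear maximal operator `𝓜_{L(log L)}`. -/
def MLlogL (f1 f2 : Rn n → ℝ) (x : Rn n) : ℝ≥0∞ :=
  ⨆ (Q : Cube n) (_ : x ∈ Q.toSet), ENNReal.ofReal (llogNorm Q f1 * llogNorm Q f2)

/-- The size condition (1.2) with constant `A`. -/
def SizeCond (K : Rn n → Rn n → Rn n → ℝ) (A : ℝ) : Prop :=
  ∀ x y1 y2 : Rn n, (x ≠ y1 ∨ x ≠ y2) →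
    |K x y1 y2| ≤ A / (dist x y1 + dist x y2) ^ (2 * (n : ℝ))

/-- The non-smooth regularity condition (1.7) with constant `D` and exponent `γ`. -/
def RegCond (K : Rn n → Rn n → Rn n → ℝ) (D γ : ℝ) : Prop :=
  ∀ x x' y1 y2 : Rn n, ∀ τ : ℝ,
    8 * dist x x' < min (dist x y1) (dist x y2) →
    2 * dist x x' < τ → 4 * τ < min (dist x y1) (dist x y2) →
    |K x y1 y2 - K x' y1 y2| ≤ D * τ ^ γ / (dist x y1 + dist x y2) ^ (2 * (n : ℝ) + γ)

/-- Bounded, measurable, compactly supported function. -/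
def BCS (f : Rn n → ℝ) : Prop :=
  Measurable f ∧ HasCompactSupport f ∧ ∃ M : ℝ, ∀ x, |f x| ≤ M

/-- `T` is the bilinear singular integral operator associated with the kernel `K`
in the sense of (1.1). -/
def AssocKernel (T : (Rn n → ℝ) → (Rn n → ℝ) → Rn n → ℝ)
    (K : Rn n → Rn n → Rn n → ℝ) : Prop :=
  ∀ f1 f2 : Rn n → ℝ, BCS f1 → BCS f2 → ∀ x : Rn n,
    x ∉ tsupport f1 ∩ tsupport f2 →
    T f1 f2 x = ∫ z : Rn n × Rn n, K x z.1 z.2 * f1 z.1 * f2 z.2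

/-- Condition (1.6): `T` maps `L¹ × L¹` boundedly into `L^{1/2,∞}`. -/
def WeakTypeBound (T : (Rn n → ℝ) → (Rn n → ℝ) → Rn n → ℝ) : Prop :=
  ∃ B : ℝ, 0 < B ∧ ∀ f1 f2 : Rn n → ℝ, Integrable f1 volume → Integrable f2 volume →
    ∀ lam : ℝ, 0 < lam →
      volume {x | lam < |T f1 f2 x|} ≤
        ENNReal.ofReal ((B * (∫ y, |f1 y|) * (∫ y, |f2 y|) / lam) ^ ((1:ℝ) / 2))

/-- The commutator `[b,T]₁(f₁,f₂) = T(b f₁, f₂) - b T(f₁,f₂)`. -/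
def comm1 (b : Rn n → ℝ) (T : (Rn n → ℝ) → (Rn n → ℝ) → Rn n → ℝ)
    (f1 f2 : Rn n → ℝ) : Rn n → ℝ :=
  fun x => T (fun y => b y * f1 y) f2 x - b x * T f1 f2 x

/-- The commutator `[b,T]₂(f₁,f₂) = T(f₁, b f₂) - b T(f₁,f₂)`. -/
def comm2 (b : Rn n → ℝ) (T : (Rn n → ℝ) → (Rn n → ℝ) → Rn n → ℝ)
    (f1 f2 : Rn n → ℝ) : Rn n → ℝ :=
  fun x => T f1 (fun y => b y * f2 y) x - b x * T f1 f2 x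

/-- The iterated commutator `T_{b⃗} = [b₂,[b₁,T]₁]₂`. -/
def itComm (b1 b2 : Rn n → ℝ) (T : (Rn n → ℝ) → (Rn n → ℝ) → Rn n → ℝ)
    (f1 f2 : Rn n → ℝ) : Rn n → ℝ :=
  comm2 b2 (comm1 b1 T) f1 f2

/-- The triple product space `ℝ^{3n}`. -/
abbrev E3 (n : ℕ) := Rn n × Rn n × Rn n

/-- A nonnegative `C_c^∞` bump function on `ℝ^{3n}` supported in
`{max(|x|,|y₁|,|y₂|) < 1}` with integral `1`. -/
def GoodPhi (φ : E3 n → ℝ) : Prop :=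
  ContDiff ℝ (⊤ : ℕ∞) φ ∧ HasCompactSupport φ ∧ (∀ u, 0 ≤ φ u) ∧
  tsupport φ ⊆ {u : E3 n | max ‖u.1‖ (max ‖u.2.1‖ ‖u.2.2‖) < 1} ∧
  ∫ u : E3 n, φ u = 1

/-- The smooth truncation `ψ^δ = φ_δ * χ^δ`. -/
def psiDelta (φ : E3 n → ℝ) (δ : ℝ) (u : E3 n) : ℝ :=
  ∫ v : E3 n, ((δ / 4) ^ (3 * n))⁻¹ * φ ((4 / δ) • (u - v)) *
    Set.indicator {w : E3 n | 3 * δ / 2 ≤ max (dist w.1 w.2.1) (dist w.1 w.2.2)}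
      (fun _ => (1:ℝ)) v

/-- The truncated kernel `K^δ = ψ^δ K`. -/
def Kdelta (φ : E3 n → ℝ) (δ : ℝ) (K : Rn n → Rn n → Rn n → ℝ) :
    Rn n → Rn n → Rn n → ℝ :=
  fun x y1 y2 => psiDelta φ δ (x, y1, y2) * K x y1 y2

/-- The truncated bilinear operator `T^δ` associated with `K^δ`. -/
def Tdelta (φ : E3 n → ℝ) (δ : ℝ) (K : Rn n → Rn n → Rn n → ℝ)
    (f1 f2 : Rn n → ℝ) : Rn n → ℝ :=
  fun x => ∫ z : Rn n × Rn n, Kdelta φ δ K x z.1 z.2 * f1 z.1 * f2 z.2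

/-- The maximal truncated bilinear singular integral operator `T^*`. -/
def Tstar (K : Rn n → Rn n → Rn n → ℝ) (f1 f2 : Rn n → ℝ) (x : Rn n) : ℝ≥0∞ :=
  ⨆ (η : ℝ) (_ : 0 < η), ENNReal.ofReal
    |∫ z : Rn n × Rn n,
      Set.indicator {z : Rn n × Rn n | η < max (dist x z.1) (dist x z.2)}
        (fun z => K x z.1 z.2 * f1 z.1 * f2 z.2) z|

end

namespace JN

/-- The children of a cube. -/
noncomputable def child {n : ℕ} (Q : Cube n) (s : Fin n → Bool) : Cube n :=
  ⟨WithLp.toLp 2 (fun i => Q.center i + (if s i then Q.side / 4 else -(Q.side / 4))),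
    Q.side / 2, by have := Q.side_pos; positivity⟩

lemma vol_pos {n : ℕ} (Q : Cube n) : 0 < Q.vol := pow_pos Q.side_pos n

lemma toSet_eq {n : ℕ} (Q : Cube n) :
    Q.toSet = (@WithLp.ofLp 2 (Fin n → ℝ)) ⁻¹'
      Metric.closedBall (WithLp.ofLp Q.center) (Q.side / 2) := by
  ext y
  have := Q.side_pos
  simp only [Cube.toSet, mem_ofPred_eq, mem_preimage, Metric.mem_closedBall]
  rw [dist_pi_le_iff (by positivity)]
  simp [Real.dist_eq]

lemma measurableSet_toSet {n : ℕ} (Q : Cube n) : MeasurableSet Q.toSet := by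
  rw [toSet_eq]
  exact (PiLp.volume_preserving_ofLp (Fin n)).measurable measurableSet_closedBall

lemma volume_toSet {n : ℕ} (Q : Cube n) : volume Q.toSet = ENNReal.ofReal Q.vol := by
  have := Q.side_pos
  rw [toSet_eq, (PiLp.volume_preserving_ofLp (Fin n)).measure_preimage
    measurableSet_closedBall.nullMeasurableSet, Real.volume_pi_closedBall _ (by positivity)]
  simp only [Fintype.card_fin, Cube.vol]
  congr 2; ring

lemma real_toSet {n : ℕ} (Q : Cube n) : volume.real Q.toSet = Q.vol := by
  rw [Measure.real, volume_toSet, ENNReal.toReal_ofReal (vol_pos Q).le]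

lemma isCompact_toSet {n : ℕ} (Q : Cube n) : IsCompact Q.toSet := by
  rw [toSet_eq]
  have h := (isCompact_closedBall (WithLp.ofLp Q.center) (Q.side / 2)).image
    (PiLp.continuous_toLp 2 (fun _ : Fin n => ℝ))
  convert h using 1
  ext y
  simp only [mem_preimage, mem_image]
  constructor
  · intro hy; exact ⟨_, hy, rfl⟩
  · rintro ⟨x, hx, rfl⟩; exact hx

lemma hyperplane_null {n : ℕ} (i : Fin n) (a : ℝ) : volume {y : Rn n | y i = a} = 0 := by
  have h := (PiLp.volume_preserving_ofLp (Fin n)).measure_preimage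
    (s := {f : Fin n → ℝ | f i = a})
    (measurableSet_eq_fun (measurable_pi_apply i) measurable_const).nullMeasurableSet
  have h2 : volume {f : Fin n → ℝ | f i = a} = 0 := by
    rw [volume_pi]; exact Measure.pi_hyperplane (fun _ : Fin n => (volume : Measure ℝ)) i a
  rw [h2] at h
  exact h

lemma child_mem {n : ℕ} (Q : Cube n) (s : Fin n → Bool) (y : Rn n) :
    y ∈ (child Q s).toSet ↔ ∀ i, |y i - (Q.center i + (if s i then Q.side / 4 else -(Q.side / 4)))|
      ≤ Q.side / 4 := by
  simp only [Cube.toSet, child, mem_ofPred_eq]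
  constructor <;> intro h i <;> have := h i <;> linarith

lemma iUnion_child {n : ℕ} (Q : Cube n) : ⋃ s, (child Q s).toSet = Q.toSet := by
  ext y
  have hs := Q.side_pos
  simp only [mem_iUnion, child_mem]
  constructor
  · rintro ⟨s, h⟩ i
    have := h i
    rw [abs_le] at this ⊢
    split_ifs at this <;> constructor <;> linarith
  · intro h
    refine ⟨fun i => decide (Q.center i ≤ y i), fun i => ?_⟩
    have := h i
    rw [abs_le] at this ⊢
    by_cases h' : Q.center i ≤ y i
    · simp only [h', decide_true, if_true]; constructor <;> linarith
    · simp only [h', decide_false]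
      push Not at h'
      simp only [Bool.false_eq_true, if_false]
      constructor <;> linarith

lemma child_subset {n : ℕ} (Q : Cube n) (s : Fin n → Bool) : (child Q s).toSet ⊆ Q.toSet := by
  rw [← iUnion_child Q]; exact subset_iUnion (fun s => (child Q s).toSet) s

lemma child_aedisjoint {n : ℕ} (Q : Cube n) :
    Pairwise (Function.onFun (AEDisjoint volume) fun s => (child Q s).toSet) := by
  intro s t hst
  obtain ⟨i, hi⟩ := Function.ne_iff.1 hst
  refine measure_mono_null ?_ (hyperplane_null i (Q.center i))
  rintro y ⟨h1, h2⟩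
  simp only [child_mem] at h1 h2
  have h1 := h1 i
  have h2 := h2 i
  rw [abs_le] at h1 h2
  simp only [mem_ofPred_eq]
  cases hs : s i <;> cases ht : t i <;> simp_all <;> linarith

lemma sum_child {n : ℕ} (Q : Cube n) (g : Rn n → ℝ) (hg : IntegrableOn g Q.toSet) :
    ∫ y in Q.toSet, g y = ∑ s, ∫ y in (child Q s).toSet, g y := by
  have := integral_iUnion_ae (fun s => (measurableSet_toSet (child Q s)).nullMeasurableSet)
    (child_aedisjoint Q) (f := g) (by rwa [iUnion_child])
  rw [iUnion_child, tsum_fintype] at this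
  exact this

lemma vol_child {n : ℕ} (Q : Cube n) (s : Fin n → Bool) : Q.vol = 2 ^ n * (child Q s).vol := by
  simp only [Cube.vol, child, div_pow]; field_simp

lemma sum_vol_child {n : ℕ} (Q : Cube n) : Q.vol = ∑ s, (child Q s).vol := by
  simp only [Cube.vol, child, div_pow]
  simp
  field_simp


/-- Truncated exponential. -/
noncomputable def phi (c M t : ℝ) : ℝ := Real.exp (min (c * |t|) M)

lemma phi_pos (c M t : ℝ) : 0 < phi c M t := Real.exp_pos _

lemma phi_le_M (c M t : ℝ) : phi c M t ≤ Real.exp M := Real.exp_le_exp.2 (min_le_right _ _)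

lemma phi_le_exp (c M t : ℝ) : phi c M t ≤ Real.exp (c * |t|) :=
  Real.exp_le_exp.2 (min_le_left _ _)

lemma phi_continuous (c M : ℝ) : Continuous (phi c M) := by unfold phi; fun_prop

lemma phi_add_le {c M : ℝ} (hc : 0 ≤ c) (s t : ℝ) :
    phi c M (s + t) ≤ Real.exp (c * |s|) * phi c M t := by
  unfold phi
  rw [← Real.exp_add, Real.exp_le_exp]
  have h : c * |s + t| ≤ c * |s| + c * |t| := by
    rw [← mul_add]; exact mul_le_mul_of_nonneg_left (abs_add_le s t) hc
  have h0 : 0 ≤ c * |s| := by positivity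
  rcases min_cases (c * |t|) M with ⟨h1, _⟩ | ⟨h1, _⟩ <;> rw [h1]
  · exact (min_le_left _ _).trans h
  · exact (min_le_right _ _).trans (by linarith)

lemma phi_add_le' {c M : ℝ} (hc : 0 ≤ c) (s t : ℝ) :
    phi c M (s + t) ≤ phi c M s + c * Real.exp M * |t| := by
  have h : c * |s + t| ≤ c * |s| + c * |t| := by
    rw [← mul_add]; exact mul_le_mul_of_nonneg_left (abs_add_le s t) hc
  have h0 : 0 ≤ c * |t| := by positivity
  set u := min (c * |s + t|) M
  set v := min (c * |s|) M
  have huv : u - v ≤ c * |t| := by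
    have : u ≤ v + c * |t| := by
      rcases min_cases (c * |s|) M with ⟨h1, _⟩ | ⟨h1, _⟩
      · have : v = c * |s| := h1
        rw [this]; exact (min_le_left _ _).trans h
      · have : v = M := h1
        rw [this]; exact (min_le_right _ _).trans (by linarith)
    linarith
  have h1 : Real.exp v = Real.exp u * Real.exp (v - u) := by rw [← Real.exp_add]; congr 1; ring
  have h2 : v - u + 1 ≤ Real.exp (v - u) := Real.add_one_le_exp _
  have h3 : Real.exp u ≤ Real.exp M := Real.exp_le_exp.2 (min_le_right _ _)
  have h4 : Real.exp u * (v - u + 1) ≤ Real.exp v := by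
    rw [h1]; exact mul_le_mul_of_nonneg_left h2 (Real.exp_pos _).le
  have h5 : Real.exp u * (u - v) ≤ Real.exp u * (c * |t|) :=
    mul_le_mul_of_nonneg_left huv (Real.exp_pos _).le
  have h6 : Real.exp u * (c * |t|) ≤ Real.exp M * (c * |t|) :=
    mul_le_mul_of_nonneg_right h3 h0
  change Real.exp u ≤ Real.exp v + _
  nlinarith

section
variable {n : ℕ}

instance (Q : Cube n) : IsFiniteMeasure (volume.restrict Q.toSet) :=
  ⟨by rw [Measure.restrict_apply_univ, volume_toSet]; exact ENNReal.ofReal_lt_top⟩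

lemma int_on {b : Rn n → ℝ} (hb : LocallyIntegrable b volume) (Q : Cube n) :
    IntegrableOn b Q.toSet := hb.integrableOn_isCompact (isCompact_toSet Q)

lemma int_sub {b h : Rn n → ℝ} (hb : LocallyIntegrable b volume) (hh : LocallyIntegrable h volume)
    (Q : Cube n) : IntegrableOn (fun y => |b y - h y|) Q.toSet :=
  ((int_on hb Q).sub (int_on hh Q)).abs

lemma int_subc {b : Rn n → ℝ} (hb : LocallyIntegrable b volume) (a : ℝ)
    (Q : Cube n) : IntegrableOn (fun y => |b y - a|) Q.toSet :=
  int_sub hb (locallyIntegrable_const a) Q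

lemma int_phi {b : Rn n → ℝ} (hb : LocallyIntegrable b volume) (c M a : ℝ)
    (Q : Cube n) : IntegrableOn (fun y => phi c M (b y - a)) Q.toSet := by
  refine Integrable.of_bound (C := Real.exp M) ?_ (Filter.Eventually.of_forall fun y => ?_)
  · exact (phi_continuous c M).comp_aestronglyMeasurable
      ((int_on hb Q).aestronglyMeasurable.sub aestronglyMeasurable_const)
  · rw [Real.norm_of_nonneg (phi_pos _ _ _).le]; exact phi_le_M _ _ _

lemma int_const (Q : Cube n) (a : ℝ) : ∫ _ in Q.toSet, a = Q.vol * a := by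
  rw [setIntegral_const, real_toSet, smul_eq_mul]

lemma avg_sub_le {b : Rn n → ℝ} (hb : LocallyIntegrable b volume) (Q : Cube n) (a : ℝ) :
    |cubeAvg Q b - a| * Q.vol ≤ ∫ y in Q.toSet, |b y - a| := by
  have hv := vol_pos Q
  have h1 : (cubeAvg Q b - a) * Q.vol = ∫ y in Q.toSet, (b y - a) := by
    rw [integral_sub (int_on hb Q) (integrable_const a), int_const]
    unfold cubeAvg; field_simp
  rw [← abs_of_pos hv, ← abs_mul, h1]
  exact abs_integral_le_integral_abs

lemma dev_eq (b : Rn n → ℝ) (Q : Cube n) :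
    ∫ y in Q.toSet, |b y - cubeAvg Q b| = bmoDev Q b * Q.vol := by
  have hv := vol_pos Q
  have h : bmoDev Q b = Q.vol⁻¹ * ∫ y in Q.toSet, |b y - cubeAvg Q b| := rfl
  rw [h, mul_comm, ← mul_assoc, mul_inv_cancel₀ hv.ne', one_mul]

lemma base_osc {b h : Rn n → ℝ} (hb : LocallyIntegrable b volume) (hh : LocallyIntegrable h volume)
    (η : ℝ) (Q : Cube n) (hη : ∀ x ∈ Q.toSet, ∀ y ∈ Q.toSet, |h x - h y| ≤ η) :
    ∫ y in Q.toSet, |b y - cubeAvg Q b| ≤ 2 * (∫ y in Q.toSet, |b y - h y|) + η * Q.vol := by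
  have hv := vol_pos Q
  set I := ∫ y in Q.toSet, |b y - h y|
  have key : ∀ y ∈ Q.toSet, |b y - cubeAvg Q b| ≤ |b y - h y| + (I / Q.vol + η) := by
    intro y hy
    have h1 := avg_sub_le hb Q (h y)
    have h2 : ∫ x in Q.toSet, |b x - h y| ≤ ∫ x in Q.toSet, (|b x - h x| + η) := by
      refine setIntegral_mono_on (int_subc hb _ Q) ((int_sub hb hh Q).add (integrable_const η))
        (measurableSet_toSet Q) fun x hx => ?_
      have := abs_sub_le (b x) (h x) (h y)
      linarith [hη x hx y hy]
    rw [integral_add (int_sub hb hh Q) (integrable_const η), int_const] at h2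
    have h3 : |cubeAvg Q b - h y| ≤ I / Q.vol + η := by
      have : I / Q.vol + η = (I + Q.vol * η) / Q.vol := by field_simp
      rw [this, le_div_iff₀ hv]; exact h1.trans h2
    have := abs_sub_le (b y) (h y) (cubeAvg Q b)
    rw [abs_sub_comm (h y)] at this
    linarith
  have h2 : ∫ y in Q.toSet, |b y - cubeAvg Q b| ≤
      ∫ y in Q.toSet, (|b y - h y| + (I / Q.vol + η)) :=
    setIntegral_mono_on (int_subc hb _ Q) ((int_sub hb hh Q).add (integrable_const _))
        (measurableSet_toSet Q) key
  rw [integral_add (int_sub hb hh Q) (integrable_const _), int_const] at h2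
  refine h2.trans (le_of_eq ?_)
  field_simp
  ring

lemma main_step {b h : Rn n → ℝ} (hb : LocallyIntegrable b volume)
    (hh : LocallyIntegrable h volume) {A c M lam F a η : ℝ} (hc : 0 ≤ c) (hlam : 0 < lam)
    (hF0 : 0 ≤ F) (hA : ∀ Q : Cube n, bmoDev Q b ≤ A)
    (hF : ∀ Q : Cube n, ∫ y in Q.toSet, phi c M (b y - cubeAvg Q b) ≤ F * Q.vol) :
    ∀ (j : ℕ) (Q : Cube n),
      (∀ x y : Rn n, (∀ i, |x i - y i| ≤ Q.side / 2 ^ j) → |h x - h y| ≤ η) →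
      |cubeAvg Q b - a| ≤ lam →
      ∫ y in Q.toSet, phi c M (b y - a) ≤
        Real.exp (c * lam) * Q.vol +
        Real.exp (c * (lam + 2 ^ n * A)) * F / lam * (∫ y in Q.toSet, |b y - a|) +
        c * Real.exp M * (2 * (∫ y in Q.toSet, |b y - h y|) + η * Q.vol) := by
  have hA0 : 0 ≤ A := by
    let Q : Cube n := ⟨0, 1, one_pos⟩
    refine le_trans ?_ (hA Q)
    have h1 := dev_eq b Q
    have h2 : 0 ≤ ∫ y in Q.toSet, |b y - cubeAvg Q b| := integral_nonneg fun _ => abs_nonneg _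
    rw [h1] at h2
    exact nonneg_of_mul_nonneg_left h2 (vol_pos Q)
  intro j
  induction j with
  | zero =>
    intro Q hη ha
    have hosc := base_osc hb hh η Q (fun x hx y hy => hη x y fun i => by
      have h1 := hx i
      have h2 := hy i
      rw [abs_le] at h1 h2 ⊢
      simp only [pow_zero, div_one]
      constructor <;> linarith)
    have h1 : ∫ y in Q.toSet, phi c M (b y - a) ≤
        ∫ y in Q.toSet, (Real.exp (c * lam) + c * Real.exp M * |b y - cubeAvg Q b|) := by
      refine setIntegral_mono_on (int_phi hb _ _ _ Q)
        ((integrable_const _).add ((int_subc hb _ Q).const_mul _))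
        (measurableSet_toSet Q) fun x hx => ?_
      have e : b x - a = (cubeAvg Q b - a) + (b x - cubeAvg Q b) := by ring
      rw [e]
      refine (phi_add_le' hc _ _).trans ?_
      gcongr
      exact (phi_le_exp _ _ _).trans (Real.exp_le_exp.2 (mul_le_mul_of_nonneg_left ha hc))
    rw [integral_add (integrable_const _) ((int_subc hb _ Q).const_mul _), int_const,
      integral_const_mul] at h1
    have h2 : 0 ≤ Real.exp (c * (lam + 2 ^ n * A)) * F / lam * (∫ y in Q.toSet, |b y - a|) :=
      mul_nonneg (by positivity) (integral_nonneg fun _ => abs_nonneg _)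
    have h3 : 0 ≤ c * Real.exp M := by positivity
    have h4 := mul_le_mul_of_nonneg_left hosc h3
    linarith
  | succ j ih =>
    intro Q hη ha
    have hη0 : 0 ≤ η := by
      have := hη 0 0 (fun i => by have := Q.side_pos; simp; positivity)
      simpa using this
    rw [sum_child Q _ (int_phi hb c M a Q), sum_child Q _ (int_subc hb a Q),
      sum_child Q _ (int_sub hb hh Q), sum_vol_child Q]
    simp only [Finset.mul_sum, ← Finset.sum_add_distrib]
    refine Finset.sum_le_sum fun s _ => ?_
    set P := child Q s
    by_cases hs : |cubeAvg P b - a| ≤ lam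
    · have := ih P (fun x y hxy => hη x y fun i => (hxy i).trans (le_of_eq (by
        simp only [P, child, pow_succ]; field_simp))) hs
      refine this.trans (le_of_eq (by ring))
    · push Not at hs
      have hvP := vol_pos P
      have h1 : |cubeAvg P b - cubeAvg Q b| ≤ 2 ^ n * A := by
        have h2 := avg_sub_le hb P (cubeAvg Q b)
        have h3 : ∫ y in P.toSet, |b y - cubeAvg Q b| ≤ ∫ y in Q.toSet, |b y - cubeAvg Q b| :=
          setIntegral_mono_set (int_subc hb _ Q) (Filter.Eventually.of_forall fun _ => abs_nonneg _)
            (child_subset Q s).eventuallyLE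
        rw [dev_eq] at h3
        have h4 := mul_le_mul_of_nonneg_right (hA Q) (vol_pos Q).le
        have h5 : Q.vol = 2 ^ n * P.vol := vol_child Q s
        rw [h5] at h3 h4
        refine le_of_mul_le_mul_right (h2.trans (h3.trans (h4.trans (le_of_eq ?_)))) hvP
        ring
      have h2 : |cubeAvg P b - a| ≤ lam + 2 ^ n * A := by
        have := abs_sub_le (cubeAvg P b) (cubeAvg Q b) a
        linarith
      have h3 : ∫ y in P.toSet, phi c M (b y - a) ≤
          ∫ y in P.toSet, Real.exp (c * (lam + 2 ^ n * A)) * phi c M (b y - cubeAvg P b) := by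
        refine setIntegral_mono_on (int_phi hb _ _ _ P) ((int_phi hb _ _ _ P).const_mul _)
          (measurableSet_toSet P) fun x hx => ?_
        have e : b x - a = (cubeAvg P b - a) + (b x - cubeAvg P b) := by ring
        rw [e]
        refine (phi_add_le hc _ _).trans ?_
        refine mul_le_mul_of_nonneg_right ?_ (phi_pos _ _ _).le
        exact Real.exp_le_exp.2 (mul_le_mul_of_nonneg_left h2 hc)
      rw [integral_const_mul] at h3
      have h4 : lam * P.vol ≤ ∫ y in P.toSet, |b y - a| :=
        (mul_le_mul_of_nonneg_right hs.le hvP.le).trans (avg_sub_le hb P a)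
      have h5 : Real.exp (c * (lam + 2 ^ n * A)) * (F * P.vol) ≤
          Real.exp (c * (lam + 2 ^ n * A)) * F / lam * ∫ y in P.toSet, |b y - a| := by
        refine le_trans (le_of_eq ?_) (mul_le_mul_of_nonneg_left h4 (by positivity))
        field_simp
      have h6 := mul_le_mul_of_nonneg_left (hF P) (Real.exp_pos (c * (lam + 2 ^ n * A))).le
      have h7 : 0 ≤ ∫ y in P.toSet, |b y - h y| := integral_nonneg fun _ => abs_nonneg _
      have h8 : 0 ≤ c * Real.exp M * (2 * (∫ y in P.toSet, |b y - h y|)) := by positivity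
      have h9 : 0 ≤ c * Real.exp M * (η * P.vol) := by positivity
      have h10 : 0 ≤ Real.exp (c * lam) * P.vol := by positivity
      linarith

lemma step_lim {b : Rn n → ℝ} (hb : LocallyIntegrable b volume)
    {A c M lam F : ℝ} (hc : 0 ≤ c) (hlam : 0 < lam)
    (hF0 : 0 ≤ F) (hA : ∀ Q : Cube n, bmoDev Q b ≤ A)
    (hF : ∀ Q : Cube n, ∫ y in Q.toSet, phi c M (b y - cubeAvg Q b) ≤ F * Q.vol) (Q : Cube n) :
    ∫ y in Q.toSet, phi c M (b y - cubeAvg Q b) ≤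
        (Real.exp (c * lam) + Real.exp (c * (lam + 2 ^ n * A)) * F / lam * A) * Q.vol := by
  have hv := vol_pos Q
  refine le_of_forall_pos_le_add fun ε hε => ?_
  set L := c * Real.exp M * (2 + Q.vol) with hL
  have hL0 : 0 ≤ L := by positivity
  set δ := ε / (L + 1) with hδ
  have hδ0 : 0 < δ := by positivity
  have hind : Integrable (Q.toSet.indicator b) :=
    (integrable_indicator_iff (measurableSet_toSet Q)).2 (int_on hb Q)
  obtain ⟨h, hsupp, hle, hcont, hint⟩ := hind.exists_hasCompactSupport_integral_sub_le hδ0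
  have huc : UniformContinuous (h ∘ (WithLp.toLp 2 : (Fin n → ℝ) → Rn n)) :=
    (hsupp.uniformContinuous_of_continuous hcont).comp (PiLp.uniformContinuous_toLp 2 _)
  obtain ⟨r, hr, hr'⟩ := Metric.uniformContinuous_iff.1 huc δ hδ0
  obtain ⟨j, hj⟩ := exists_pow_lt_of_lt_one (show 0 < r / Q.side from div_pos hr Q.side_pos)
    (show (1 / 2 : ℝ) < 1 by norm_num)
  have hj' : Q.side / 2 ^ j < r := by
    rw [lt_div_iff₀ Q.side_pos] at hj
    have : Q.side / 2 ^ j = (1 / 2) ^ j * Q.side := by rw [div_pow, one_pow]; ring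
    rw [this]; exact hj
  have key := main_step hb hcont.locallyIntegrable (a := cubeAvg Q b) (η := δ) hc hlam hF0 hA hF j Q
    (fun x y hxy => by
      have hd : dist (WithLp.ofLp x) (WithLp.ofLp y) < r := by
        rw [dist_pi_lt_iff hr]
        intro i
        rw [Real.dist_eq]
        exact (hxy i).trans_lt hj'
      have := hr' hd
      rw [Real.dist_eq] at this
      exact this.le)
    (by simpa using hlam.le)
  have h1 : ∫ y in Q.toSet, |b y - h y| ≤ δ := by
    refine le_trans ?_ hle
    refine le_trans (le_of_eq ?_) (setIntegral_le_integral (s := Q.toSet) (hind.sub hint).norm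
      (Filter.Eventually.of_forall fun _ => norm_nonneg _))
    refine setIntegral_congr_fun (measurableSet_toSet Q) fun y hy => ?_
    simp [hy]
  rw [dev_eq] at key
  have h2 : Real.exp (c * (lam + 2 ^ n * A)) * F / lam * (bmoDev Q b * Q.vol) ≤
      Real.exp (c * (lam + 2 ^ n * A)) * F / lam * (A * Q.vol) := by
    have := hA Q
    gcongr
  have h3 : c * Real.exp M * (2 * (∫ y in Q.toSet, |b y - h y|) + δ * Q.vol) ≤
      c * Real.exp M * (2 * δ + δ * Q.vol) := by gcongr
  have h4 : c * Real.exp M * (2 * δ + δ * Q.vol) = L * δ := by rw [hL]; ring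
  have h5 : L * δ ≤ ε := by
    rw [hδ, mul_div_assoc', div_le_iff₀ (by positivity)]
    nlinarith
  linarith

lemma jn_trunc {b : Rn n → ℝ} (hb : LocallyIntegrable b volume)
    {A : ℝ} (hA0 : 0 < A) (hA : ∀ Q : Cube n, bmoDev Q b ≤ A) (M : ℝ) (Q : Cube n) :
    ∫ y in Q.toSet, phi (1 / ((2 * Real.exp 1 + 2 ^ n) * A)) M (b y - cubeAvg Q b) ≤
      (2 * Real.exp 1) * Q.vol := by
  set c := 1 / ((2 * Real.exp 1 + 2 ^ n) * A) with hc
  have he : 0 < Real.exp 1 := Real.exp_pos 1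
  have hc0 : 0 < c := by positivity
  let g : Cube n → ℝ := fun Q => (∫ y in Q.toSet, phi c M (b y - cubeAvg Q b)) / Q.vol
  have hbd : BddAbove (range g) := by
    refine ⟨Real.exp M, ?_⟩
    rintro _ ⟨P, rfl⟩
    have hv := vol_pos P
    change _ / _ ≤ _
    rw [div_le_iff₀ hv]
    have := setIntegral_mono_on (int_phi hb c M (cubeAvg P b) P)
      (integrable_const (Real.exp M)) (measurableSet_toSet P) fun x _ => phi_le_M _ _ _
    rw [int_const] at this
    linarith
  set F := ⨆ P, g P with hFdef
  have hgF : ∀ P, g P ≤ F := fun P => le_ciSup hbd P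
  have hF0 : 0 ≤ F := le_trans
    (div_nonneg (integral_nonneg fun _ => (phi_pos _ _ _).le) (vol_pos Q).le) (hgF Q)
  have hF : ∀ P : Cube n, ∫ y in P.toSet, phi c M (b y - cubeAvg P b) ≤ F * P.vol := fun P =>
    (div_le_iff₀ (vol_pos P)).1 (hgF P)
  have hstep := step_lim hb hc0.le (lam := 2 * Real.exp 1 * A) (by positivity) hF0 hA hF
  have e1 : c * (2 * Real.exp 1 * A + 2 ^ n * A) = 1 := by rw [hc]; field_simp
  have e2 : c * (2 * Real.exp 1 * A) ≤ 1 := by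
    refine le_trans (mul_le_mul_of_nonneg_left ?_ hc0.le) e1.le
    have : 0 ≤ 2 ^ n * A := by positivity
    linarith
  have e3 : Real.exp 1 * F / (2 * Real.exp 1 * A) * A = F / 2 := by field_simp
  have hF2 : F ≤ Real.exp 1 + F / 2 := by
    refine ciSup_le fun P => ?_
    change _ / _ ≤ _
    rw [div_le_iff₀ (vol_pos P)]
    refine (hstep P).trans ?_
    rw [e1, e3]
    have := Real.exp_le_exp.2 e2
    have := vol_pos P
    gcongr
  refine (hF Q).trans ?_
  have := vol_pos Q
  gcongr
  linarith

/-- The John–Nirenberg inequality in exponential form. -/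
lemma jn {b : Rn n → ℝ} (hb : LocallyIntegrable b volume)
    {A : ℝ} (hA0 : 0 < A) (hA : ∀ Q : Cube n, bmoDev Q b ≤ A) (Q : Cube n) :
    ∫⁻ y in Q.toSet, ENNReal.ofReal (Real.exp (1 / ((2 * Real.exp 1 + 2 ^ n) * A) *
      |b y - cubeAvg Q b|)) ≤ ENNReal.ofReal ((2 * Real.exp 1) * Q.vol) := by
  set c := 1 / ((2 * Real.exp 1 + 2 ^ n) * A) with hc
  have ht := lintegral_tendsto_of_tendsto_of_monotone (μ := volume.restrict Q.toSet)
    (f := fun (k : ℕ) y => ENNReal.ofReal (phi c k (b y - cubeAvg Q b)))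
    (F := fun y => ENNReal.ofReal (Real.exp (c * |b y - cubeAvg Q b|)))
    (fun k => (int_phi hb c k (cubeAvg Q b) Q).aestronglyMeasurable.aemeasurable.ennreal_ofReal)
    (Filter.Eventually.of_forall fun y k l hkl => by
      refine ENNReal.ofReal_le_ofReal (Real.exp_le_exp.2 (min_le_min_left _ ?_))
      exact_mod_cast hkl)
    (Filter.Eventually.of_forall fun y => by
      obtain ⟨K, hK⟩ := exists_nat_ge (c * |b y - cubeAvg Q b|)
      refine tendsto_const_nhds.congr' ?_
      filter_upwards [Filter.eventually_ge_atTop K] with k hk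
      have : (K : ℝ) ≤ k := by exact_mod_cast hk
      rw [phi, min_eq_left (hK.trans this)])
  refine le_of_tendsto' ht fun k => ?_
  rw [← ofReal_integral_eq_lintegral_ofReal (int_phi hb c k (cubeAvg Q b) Q)
    (Filter.Eventually.of_forall fun _ => (phi_pos _ _ _).le)]
  exact ENNReal.ofReal_le_ofReal (jn_trunc hb hA0 hA k Q)

lemma young {s t : ℝ} (ht : 0 ≤ t) : s * t ≤ PhiLL t + Real.exp s := by
  unfold PhiLL
  rcases ht.eq_or_lt with rfl | ht
  · simp; positivity
  have h := Real.add_one_le_exp (s - Real.log t)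
  rw [Real.exp_sub, Real.exp_log ht, le_div_iff₀ ht] at h
  have h2 := mul_le_mul_of_nonneg_left (le_max_left (Real.log t) 0) ht.le
  nlinarith

lemma PhiLL_nonneg {t : ℝ} (ht : 0 ≤ t) : 0 ≤ PhiLL t :=
  mul_nonneg ht (by have := le_max_right (Real.log t) 0; linarith)

lemma holder_lam {b f : Rn n → ℝ} (hb : LocallyIntegrable b volume) (hf : Measurable f)
    {A : ℝ} (hA0 : 0 < A) (hA : ∀ Q : Cube n, bmoDev Q b ≤ A) (Q : Cube n) {lam : ℝ}
    (hlam : 0 < lam)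
    (hfl : ∫⁻ y in Q.toSet, ENNReal.ofReal (PhiLL (|f y| / lam)) ≤ ENNReal.ofReal Q.vol) :
    (ENNReal.ofReal Q.vol)⁻¹ *
          ∫⁻ y in Q.toSet, ENNReal.ofReal (|b y - cubeAvg Q b| * |f y|) ≤
        ENNReal.ofReal ((2 * Real.exp 1 + 2 ^ n) * (1 + 2 * Real.exp 1) * A * lam) := by
  have he : 0 < Real.exp 1 := Real.exp_pos 1
  have hv := vol_pos Q
  have hj := jn hb hA0 hA Q
  set D := 2 * Real.exp 1 + 2 ^ n with hD
  have hD0 : 0 < D := by positivity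
  have hpt : ∀ y, ENNReal.ofReal (|b y - cubeAvg Q b| * |f y|) ≤ ENNReal.ofReal (D * A * lam) *
      (ENNReal.ofReal (PhiLL (|f y| / lam)) +
        ENNReal.ofReal (Real.exp (1 / (D * A) * |b y - cubeAvg Q b|))) := by
    intro y
    have h0 : 0 ≤ |f y| / lam := by positivity
    rw [← ENNReal.ofReal_add (PhiLL_nonneg h0) (Real.exp_pos _).le,
      ← ENNReal.ofReal_mul (by positivity)]
    refine ENNReal.ofReal_le_ofReal ?_
    refine le_trans (le_of_eq ?_) (mul_le_mul_of_nonneg_left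
      (young (s := 1 / (D * A) * |b y - cubeAvg Q b|) h0) (by positivity))
    field_simp
  have hm : Measurable fun y => ENNReal.ofReal (PhiLL (|f y| / lam)) := by
    unfold PhiLL
    fun_prop
  have h1 : ∫⁻ y in Q.toSet, ENNReal.ofReal (|b y - cubeAvg Q b| * |f y|) ≤
      ENNReal.ofReal (D * A * lam) * (ENNReal.ofReal Q.vol +
        ENNReal.ofReal ((2 * Real.exp 1) * Q.vol)) := by
    refine (lintegral_mono hpt).trans ?_
    rw [lintegral_const_mul' _ _ ENNReal.ofReal_ne_top, lintegral_add_left hm]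
    gcongr
  rw [← ENNReal.ofReal_add hv.le (by positivity), ← ENNReal.ofReal_mul (by positivity)] at h1
  refine (mul_le_mul_right h1 _).trans ?_
  rw [← ENNReal.ofReal_inv_of_pos hv, ← ENNReal.ofReal_mul (by positivity)]
  refine ENNReal.ofReal_le_ofReal (le_of_eq ?_)
  field_simp

end

end JN

/-- the generalized Hölder inequality
`|Q|⁻¹ ∫_Q |b - b_Q| |f| ≤ C ‖b‖_{BMO} ‖f‖_{L(log L),Q}`. -/
theorem stmt12 {n : ℕ} (hn : 0 < n) :
    ∃ C : ℝ, 0 < C ∧ ∀ (Q : Cube n) (b f : Rn n → ℝ),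
      MemBMO b → Measurable f →
      (∃ lam : ℝ, 0 < lam ∧
        ∫⁻ y in Q.toSet, ENNReal.ofReal (PhiLL (|f y| / lam)) ≤ ENNReal.ofReal Q.vol) →
      (ENNReal.ofReal Q.vol)⁻¹ *
          ∫⁻ y in Q.toSet, ENNReal.ofReal (|b y - cubeAvg Q b| * |f y|) ≤
        ENNReal.ofReal (C * bmoNorm b * llogNorm Q f) := by
  have he : 0 < Real.exp 1 := Real.exp_pos 1
  set D := (2 * Real.exp 1 + 2 ^ n) * (1 + 2 * Real.exp 1) with hD
  have hD0 : 0 < D := by positivity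
  refine ⟨D, hD0, fun Q b f hb hf hex => ?_⟩
  obtain ⟨hloc, hbdd⟩ := hb
  have hle : ∀ P : Cube n, bmoDev P b ≤ bmoNorm b := fun P => le_ciSup hbdd P
  have hN : 0 ≤ bmoNorm b := by
    refine le_trans ?_ (hle Q)
    have h2 : 0 ≤ ∫ y in Q.toSet, |b y - cubeAvg Q b| := integral_nonneg fun _ => abs_nonneg _
    rw [JN.dev_eq] at h2
    exact nonneg_of_mul_nonneg_left h2 (JN.vol_pos Q)
  set S := {lam : ℝ | 0 < lam ∧
    ∫⁻ y in Q.toSet, ENNReal.ofReal (PhiLL (|f y| / lam)) ≤ ENNReal.ofReal Q.vol} with hS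
  have hSne : S.Nonempty := hex
  have hSb : BddBelow S := ⟨0, fun x hx => hx.1.le⟩
  have hmain : ∀ ε : ℝ, 0 < ε → (ENNReal.ofReal Q.vol)⁻¹ *
          ∫⁻ y in Q.toSet, ENNReal.ofReal (|b y - cubeAvg Q b| * |f y|) ≤
        ENNReal.ofReal (D * (bmoNorm b + ε) * (llogNorm Q f + ε)) := by
    intro ε hε
    have hlt : sInf S < llogNorm Q f + ε := by
      change llogNorm Q f < _; linarith
    obtain ⟨lam, hlamS, hlam⟩ := (csInf_lt_iff hSb hSne).1 hlt
    refine (JN.holder_lam hloc hf (A := bmoNorm b + ε) (by linarith)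
      (fun P => (hle P).trans (by linarith)) Q hlamS.1 hlamS.2).trans ?_
    refine ENNReal.ofReal_le_ofReal ?_
    have : 0 ≤ D * (bmoNorm b + ε) := by positivity
    exact mul_le_mul_of_nonneg_left hlam.le this
  have hcont : Filter.Tendsto
      (fun ε : ℝ => ENNReal.ofReal (D * (bmoNorm b + ε) * (llogNorm Q f + ε)))
      (nhdsWithin 0 (Set.Ioi 0)) (nhds (ENNReal.ofReal (D * bmoNorm b * llogNorm Q f))) := by
    have hc : Continuous fun ε : ℝ =>
      ENNReal.ofReal (D * (bmoNorm b + ε) * (llogNorm Q f + ε)) :=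
      ENNReal.continuous_ofReal.comp (by fun_prop)
    have := (hc.tendsto 0).mono_left (nhdsWithin_le_nhds (s := Set.Ioi 0))
    simpa using this
  refine ge_of_tendsto hcont ?_
  filter_upwards [self_mem_nhdsWithin] with ε hε
  exact hmain ε hε
end

section
/- Let K satisfy the size condition (1.2) and the non-smooth regularity condition (1.7) with exponent gamma in (0,1], and for delta > 0 let K^delta(x,y1,y2) = psi^delta(x,y1,y2) K(x,y1,y2), where psi^delta is the smooth truncation. Then K^delta also satisfies the size condition (1.2) and the non-smooth regularity condition (1.7) with the same exponent gamma, with constants independent of delta. -/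
open MeasureTheory ENNReal Set

theorem aux_haar (n : ℕ) : (volume : Measure (E3 n)).IsAddHaarMeasure := by
  have h : (volume : Measure (Rn n × Rn n)).IsAddHaarMeasure :=
    Measure.prod.instIsAddHaarMeasure _ _
  exact Measure.prod.instIsAddHaarMeasure _ _

theorem aux_neg (n : ℕ) : (volume : Measure (E3 n)).IsNegInvariant := by
  have := aux_haar n
  have : (volume : Measure (E3 n)).Regular := by
    have : IsLocallyFiniteMeasure (volume : Measure (E3 n)) :=
      isLocallyFiniteMeasure_of_isFiniteMeasureOnCompacts
    exact Measure.Regular.of_sigmaCompactSpace_of_isLocallyFiniteMeasure _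
  exact Measure.IsAddHaarMeasure.isNegInvariant_of_regular _

theorem aux_subst {n : ℕ} (g : E3 n → ℝ) {δ : ℝ} (hδ : 0 < δ) (u : E3 n) :
    ∫ v : E3 n, ((δ / 4) ^ (3 * n))⁻¹ * g ((4 / δ) • (u - v)) = ∫ w, g w := by
  have := aux_haar n
  have := aux_neg n
  rw [integral_const_mul, integral_sub_left_eq_self (fun v => g ((4 / δ) • v)) volume u,
    Measure.integral_comp_smul]
  have h : Module.finrank ℝ (E3 n) = 3 * n := by
    simp [E3, Rn]; ring
  rw [h, smul_eq_mul, abs_of_pos (by positivity), ← mul_assoc, ← mul_inv, ← mul_pow]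
  have : δ / 4 * (4 / δ) = 1 := by field_simp
  simp [this]

theorem aux_integrable {n : ℕ} (φ : E3 n → ℝ) (hφ : GoodPhi φ) {δ : ℝ} (hδ : 0 < δ) (u : E3 n) :
    Integrable (fun v : E3 n => ((δ / 4) ^ (3 * n))⁻¹ * φ ((4 / δ) • (u - v))) := by
  have := aux_haar n
  have := aux_neg n
  have h0 : Integrable φ := hφ.1.continuous.integrable_of_hasCompactSupport hφ.2.1
  exact ((h0.comp_smul (R := 4 / δ) (by positivity)).comp_sub_left u).const_mul _

theorem aux_meas {n : ℕ} (δ : ℝ) :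
    MeasurableSet {w : E3 n | 3 * δ / 2 ≤ max (dist w.1 w.2.1) (dist w.1 w.2.2)} := by
  apply IsClosed.measurableSet
  exact isClosed_le (by fun_prop) (by fun_prop)

theorem aux_integrable' {n : ℕ} (φ : E3 n → ℝ) (hφ : GoodPhi φ) {δ : ℝ} (hδ : 0 < δ) (u : E3 n) :
    Integrable (fun v : E3 n => ((δ / 4) ^ (3 * n))⁻¹ * φ ((4 / δ) • (u - v)) *
    Set.indicator {w : E3 n | 3 * δ / 2 ≤ max (dist w.1 w.2.1) (dist w.1 w.2.2)}
      (fun _ => (1:ℝ)) v) := by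
  have h := (aux_integrable φ hφ hδ u).indicator (aux_meas (n := n) δ)
  refine h.congr (Filter.Eventually.of_forall fun v => ?_)
  simp only [Set.indicator]
  split_ifs <;> simp

theorem aux_supp {n : ℕ} (φ : E3 n → ℝ) (hφ : GoodPhi φ) (u : E3 n) (hu : φ u ≠ 0) : ‖u‖ < 1 := by
  have := hφ.2.2.2.1 (subset_tsupport _ hu)
  simpa [Prod.norm_def] using this

theorem aux_psi_nonneg {n : ℕ} (φ : E3 n → ℝ) (hφ : GoodPhi φ) {δ : ℝ} (hδ : 0 < δ) (u : E3 n) :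
    0 ≤ psiDelta φ δ u := by
  apply integral_nonneg
  intro v
  have := hφ.2.2.1 ((4 / δ) • (u - v))
  have h2 := Set.indicator_nonneg (s := {w : E3 n | 3 * δ / 2 ≤ max (dist w.1 w.2.1) (dist w.1 w.2.2)})
    (f := fun _ => (1:ℝ)) (fun _ _ => zero_le_one) v
  exact mul_nonneg (mul_nonneg (by positivity) this) h2

theorem aux_psi_le {n : ℕ} (φ : E3 n → ℝ) (hφ : GoodPhi φ) {δ : ℝ} (hδ : 0 < δ) (u : E3 n) :
    psiDelta φ δ u ≤ 1 := by
  rw [← hφ.2.2.2.2, ← aux_subst φ hδ u]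
  apply integral_mono (aux_integrable' φ hφ hδ u) (aux_integrable φ hφ hδ u)
  intro v
  have := hφ.2.2.1 ((4 / δ) • (u - v))
  refine mul_le_of_le_one_right (mul_nonneg (by positivity) this) ?_
  exact Set.indicator_le_self' (fun _ _ => zero_le_one) v

theorem aux_psi_one {n : ℕ} (φ : E3 n → ℝ) (hφ : GoodPhi φ) {δ : ℝ} (hδ : 0 < δ) (u : E3 n)
    (hu : 2 * δ ≤ max (dist u.1 u.2.1) (dist u.1 u.2.2)) : psiDelta φ δ u = 1 := by
  rw [← hφ.2.2.2.2, ← aux_subst φ hδ u]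
  refine integral_congr_ae (Filter.Eventually.of_forall fun v => ?_)
  by_cases h : φ ((4 / δ) • (u - v)) = 0
  · simp [h]
  · have h1 := aux_supp φ hφ _ h
    rw [norm_smul, Real.norm_of_nonneg (by positivity), div_mul_eq_mul_div, div_lt_one hδ,
      ← dist_eq_norm, Prod.dist_eq, Prod.dist_eq] at h1
    have ha := le_max_left (dist u.1 v.1) (max (dist u.2.1 v.2.1) (dist u.2.2 v.2.2))
    have hb := le_max_right (dist u.1 v.1) (max (dist u.2.1 v.2.1) (dist u.2.2 v.2.2))
    have hc := le_max_left (dist u.2.1 v.2.1) (dist u.2.2 v.2.2)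
    have hd := le_max_right (dist u.2.1 v.2.1) (dist u.2.2 v.2.2)
    have t1 := dist_triangle4 u.1 v.1 v.2.1 u.2.1
    have t2 := dist_triangle4 u.1 v.1 v.2.2 u.2.2
    rw [dist_comm v.2.1] at t1
    rw [dist_comm v.2.2] at t2
    have hv : v ∈ {w : E3 n | 3 * δ / 2 ≤ max (dist w.1 w.2.1) (dist w.1 w.2.2)} := by
      simp only [Set.mem_ofPred_eq, le_max_iff] at hu ⊢
      rcases hu with hu | hu
      · left; linarith
      · right; linarith
    simp only [Set.indicator_of_mem hv, mul_one]

theorem aux_psi_lip {n : ℕ} (φ : E3 n → ℝ) (hφ : GoodPhi φ) : ∃ C : ℝ, 0 ≤ C ∧ ∀ δ : ℝ, 0 < δ →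
    ∀ u u' : E3 n, |psiDelta φ δ u - psiDelta φ δ u'| ≤ C * (dist u u' / δ) := by
  obtain ⟨L, hL⟩ := ContDiff.lipschitzWith_of_hasCompactSupport hφ.2.1 hφ.1 (by simp)
  have := aux_haar n
  set B : Set (E3 n) := Metric.ball 0 1 with hB
  refine ⟨L * (2 * volume.real B) * 4, by positivity, fun δ hδ u u' => ?_⟩
  set h : E3 n := (4 / δ) • (u' - u) with hh
  have hhn : ‖h‖ = 4 * (dist u u' / δ) := by
    rw [hh, norm_smul, Real.norm_of_nonneg (by positivity), dist_comm, dist_eq_norm]; ring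
  have hBm : MeasurableSet B := Metric.isOpen_ball.measurableSet
  have hBi : Integrable (B.indicator (fun _ => (1:ℝ))) := by
    refine IntegrableOn.integrable_indicator ?_ hBm
    exact integrableOn_const (by exact measure_ball_lt_top.ne)
  have hBi2 : Integrable (fun w => B.indicator (fun _ => (1:ℝ)) (w + h)) := hBi.comp_add_right h
  have := aux_haar n
  have := aux_neg n
  have h0 : Integrable φ := hφ.1.continuous.integrable_of_hasCompactSupport hφ.2.1
  have step2 : ∫ w, |φ w - φ (w + h)| ≤ L * (2 * volume.real B) * ‖h‖ := by
    calc ∫ w, |φ w - φ (w + h)| ≤ ∫ w, (L * ‖h‖) *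
          (B.indicator (fun _ => (1:ℝ)) w + B.indicator (fun _ => (1:ℝ)) (w + h)) := by
          apply integral_mono (h0.sub (h0.comp_add_right h)).abs ((hBi.add hBi2).const_mul _)
          intro w
          change |φ w - φ (w + h)| ≤ (L * ‖h‖) *
            (B.indicator (fun _ => (1:ℝ)) w + B.indicator (fun _ => (1:ℝ)) (w + h))
          have i1 : ∀ z, 0 ≤ B.indicator (fun _ => (1:ℝ)) z :=
            fun z => Set.indicator_nonneg (fun _ _ => zero_le_one) z
          have hl : |φ w - φ (w + h)| ≤ L * ‖h‖ := by
            have := hL.dist_le_mul w (w + h)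
            simpa [Real.dist_eq] using this
          have hLh : 0 ≤ L * ‖h‖ := by positivity
          by_cases hw : φ w = 0
          · by_cases hw' : φ (w + h) = 0
            · simp only [hw, hw', sub_self, abs_zero]
              exact mul_nonneg hLh (add_nonneg (i1 _) (i1 _))
            · have : w + h ∈ B := by simpa [hB] using aux_supp φ hφ _ hw'
              refine hl.trans (le_mul_of_one_le_right hLh ?_)
              rw [Set.indicator_of_mem this]
              linarith [i1 w]
          · have : w ∈ B := by simpa [hB] using aux_supp φ hφ _ hw
            refine hl.trans (le_mul_of_one_le_right hLh ?_)
            rw [Set.indicator_of_mem this]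
            linarith [i1 (w + h)]
      _ = L * (2 * volume.real B) * ‖h‖ := by
          rw [integral_const_mul, integral_add hBi hBi2,
            integral_add_right_eq_self (fun w => B.indicator (fun _ => (1:ℝ)) w) h,
            integral_indicator hBm]
          simp
          ring
  have step1 : |psiDelta φ δ u - psiDelta φ δ u'| ≤ ∫ w, |φ w - φ (w + h)| := by
    rw [← aux_subst (fun w => |φ w - φ (w + h)|) hδ u]
    unfold psiDelta
    rw [← integral_sub (aux_integrable' φ hφ hδ u) (aux_integrable' φ hφ hδ u')]
    refine (abs_integral_le_integral_abs).trans ?_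
    have key : ∀ v, (4 / δ) • (u - v) + h = (4 / δ) • (u' - v) := by
      intro v; rw [hh, ← smul_add]; congr 1; abel
    apply integral_mono
      ((aux_integrable' φ hφ hδ u).sub (aux_integrable' φ hφ hδ u')).abs
    · have := ((aux_integrable φ hφ hδ u).sub (aux_integrable φ hφ hδ u')).abs
      refine this.congr (Filter.Eventually.of_forall fun v => ?_)
      simp only [key, Pi.sub_apply]
      rw [← mul_sub, abs_mul, abs_of_pos (a := ((δ / 4) ^ (3 * n))⁻¹) (by positivity)]
    · intro v
      simp only [key, Pi.sub_apply]
      rw [← sub_mul, ← mul_sub, abs_mul, abs_mul,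
        abs_of_pos (a := ((δ / 4) ^ (3 * n))⁻¹) (by positivity)]
      refine mul_le_of_le_one_right (by positivity) ?_
      simp only [Set.indicator]
      split_ifs <;> simp
  calc _ ≤ _ := step1
    _ ≤ _ := step2
    _ = _ := by rw [hhn]; ring

/-- the truncated kernels `K^δ` satisfy the size condition (1.2)
and the regularity condition (1.7) with constants independent of `δ`. -/
theorem stmt14 {n : ℕ} (hn : 0 < n)
    (K : Rn n → Rn n → Rn n → ℝ)
    (A D γ : ℝ) (hA : 0 < A) (hD : 0 < D) (hγ0 : 0 < γ) (hγ1 : γ ≤ 1)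
    (hsize : SizeCond K A) (hreg : RegCond K D γ)
    (φ : E3 n → ℝ) (hφ : GoodPhi φ) :
    ∃ A' D' : ℝ, 0 < A' ∧ 0 < D' ∧ ∀ δ : ℝ, 0 < δ →
      SizeCond (Kdelta φ δ K) A' ∧ RegCond (Kdelta φ δ K) D' γ := by
  obtain ⟨C, hC, hlip⟩ := aux_psi_lip φ hφ
  refine ⟨A, D + C * 5 * A, hA, by positivity, fun δ hδ => ⟨?_, ?_⟩⟩
  · intro x y1 y2 hxy
    refine le_trans ?_ (hsize x y1 y2 hxy)
    rw [Kdelta, abs_mul, abs_of_nonneg (aux_psi_nonneg φ hφ hδ _)]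
    exact mul_le_of_le_one_left (abs_nonneg _) (aux_psi_le φ hφ hδ _)
  · intro x x' y1 y2 τ h8 h2 h4
    have hd := dist_nonneg (x := x) (y := x')
    have hτ : 0 < τ := by linarith
    have hm1 := lt_of_lt_of_le h4 (min_le_left _ _)
    have hm2 := lt_of_lt_of_le h4 (min_le_right _ _)
    have h81 := lt_of_lt_of_le h8 (min_le_left _ _)
    have h82 := lt_of_lt_of_le h8 (min_le_right _ _)
    have hR := hreg x x' y1 y2 τ h8 h2 h4
    have hS := hsize x y1 y2 (Or.inl (by
      intro h; rw [h, dist_self] at hm1; linarith))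
    set S := dist x y1 + dist x y2 with hSdef
    have hSpos : 0 < S := by linarith
    have hpsi : |psiDelta φ δ (x, y1, y2) - psiDelta φ δ (x', y1, y2)| ≤ C * 5 * (τ / S) ^ γ := by
      have hq : 0 < τ / S := by positivity
      have hq1 : τ / S ≤ 1 := by rw [div_le_one hSpos]; linarith
      have hqg : τ / S ≤ (τ / S) ^ γ := by
        simpa using Real.rpow_le_rpow_of_exponent_ge hq hq1 hγ1
      by_cases hbig : 2 * δ ≤ max (dist x y1) (dist x y2) ∧ 2 * δ ≤ max (dist x' y1) (dist x' y2)
      · have e1 := aux_psi_one φ hφ hδ (x, y1, y2) hbig.1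
        have e2 := aux_psi_one φ hφ hδ (x', y1, y2) hbig.2
        rw [e1, e2]
        simp only [sub_self, abs_zero]
        positivity
      · have t1 := dist_triangle x x' y1
        have t2 := dist_triangle x x' y2
        have hS5 : S ≤ 5 * δ := by
          rw [not_and_or, not_le, not_le, max_lt_iff, max_lt_iff] at hbig
          rcases hbig with h | h
          · linarith [h.1, h.2]
          · linarith [h.1, h.2]
        have hdist : dist ((x, y1, y2) : E3 n) (x', y1, y2) = dist x x' := by
          simp [Prod.dist_eq]
        have := hlip δ hδ (x, y1, y2) (x', y1, y2)
        rw [hdist] at this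
        have h5 : dist x x' / δ ≤ 5 * (τ / S) := by
          rw [div_le_iff₀ hδ, mul_div_assoc', div_mul_eq_mul_div, le_div_iff₀ hSpos]
          nlinarith
        calc _ ≤ _ := this
          _ ≤ C * (5 * (τ / S) ^ γ) := by gcongr; linarith
          _ = _ := by ring
    have e : Kdelta φ δ K x y1 y2 - Kdelta φ δ K x' y1 y2
        = psiDelta φ δ (x', y1, y2) * (K x y1 y2 - K x' y1 y2)
          + (psiDelta φ δ (x, y1, y2) - psiDelta φ δ (x', y1, y2)) * K x y1 y2 := by
      simp only [Kdelta]; ring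
    rw [e]
    refine (abs_add_le _ _).trans ?_
    rw [abs_mul, abs_mul, abs_of_nonneg (aux_psi_nonneg φ hφ hδ _)]
    have p1 : psiDelta φ δ (x', y1, y2) * |K x y1 y2 - K x' y1 y2|
        ≤ D * τ ^ γ / S ^ (2 * (n : ℝ) + γ) :=
      (mul_le_of_le_one_left (abs_nonneg _) (aux_psi_le φ hφ hδ _)).trans hR
    have p2 := mul_le_mul hpsi hS (abs_nonneg _) (by positivity)
    refine (add_le_add p1 p2).trans (le_of_eq ?_)
    rw [Real.div_rpow hτ.le hSpos.le, Real.rpow_add hSpos]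
    field_simp
end

section
/- Let K satisfy the size condition (1.2), let delta > 0, let K^delta be the smooth truncation of K, and let b be in C_c^infinity(R^n). Fix 0 < beta < 1. For 0 < eta < delta and x in R^n, set C(x) = int int over {(y1,y2): min(|x-y1|,|x-y2|) < eta} of K^delta(x,y1,y2)(b(y1) - b(x)) f1(y1) f2(y2) dy1 dy2. Then there is a constant C, depending on b and beta but independent of x, eta, delta, f1 and f2, such that for all bounded compactly supported f1,f2: |C(x)| <= C ( eta M_{2,1}(f1,f2)(x) + eta^beta M^2_beta(f1,f2)(x) ). -/
open MeasureTheory ENNReal Set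

theorem psi_bound {n : ℕ} (φ : E3 n → ℝ) (hφ : GoodPhi φ) (δ : ℝ) (hδ : 0 < δ) (u : E3 n) :
    |psiDelta φ δ u| ≤ 1 := by
  obtain ⟨hsm, hcs, hpos, hsupp, hint⟩ := hφ
  have i2 : (volume : Measure (Rn n × Rn n)).IsAddHaarMeasure :=
    Measure.prod.instIsAddHaarMeasure (volume : Measure (Rn n)) (volume : Measure (Rn n))
  have i3 : (volume : Measure (E3 n)).IsAddHaarMeasure :=
    Measure.prod.instIsAddHaarMeasure (volume : Measure (Rn n)) (volume : Measure (Rn n × Rn n))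
  have i5 : BorelSpace (E3 n) := Prod.borelSpace
  have i6 : (volume : Measure (E3 n)).Regular :=
    Measure.Regular.of_sigmaCompactSpace_of_isLocallyFiniteMeasure _
  have i4 : (volume : Measure (E3 n)).IsNegInvariant :=
    Measure.IsAddHaarMeasure.isNegInvariant_of_regular _
  have hI : Integrable φ := hsm.continuous.integrable_of_hasCompactSupport hcs
  have h4 : (4 / δ) ≠ 0 := by positivity
  have hI2 : Integrable (fun v : E3 n => φ ((4 / δ) • (u - v))) := by
    have := (hI.comp_smul h4).comp_sub_left u
    exact this
  have hval : ∫ v : E3 n, ((δ / 4) ^ (3 * n))⁻¹ * φ ((4 / δ) • (u - v)) = 1 := by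
    rw [integral_const_mul, integral_sub_left_eq_self (fun v => φ ((4 / δ) • v)) volume u,
      Measure.integral_comp_smul, hint]
    have hd : Module.finrank ℝ (E3 n) = 3 * n := by
      simp [E3]; ring
    rw [hd, abs_of_pos (by positivity)]
    rw [smul_eq_mul, mul_one, ← mul_inv, ← mul_pow]
    have : δ / 4 * (4 / δ) = 1 := by field_simp
    rw [this]; simp
  have hle : ∀ v : E3 n, ‖((δ / 4) ^ (3 * n))⁻¹ * φ ((4 / δ) • (u - v)) *
    Set.indicator {w : E3 n | 3 * δ / 2 ≤ max (dist w.1 w.2.1) (dist w.1 w.2.2)}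
      (fun _ => (1:ℝ)) v‖ ≤ ((δ / 4) ^ (3 * n))⁻¹ * φ ((4 / δ) • (u - v)) := by
    intro v
    have h0 : 0 ≤ ((δ / 4) ^ (3 * n))⁻¹ * φ ((4 / δ) • (u - v)) :=
      mul_nonneg (by positivity) (hpos _)
    rw [norm_mul, Real.norm_of_nonneg h0]
    apply mul_le_of_le_one_right h0
    by_cases hv : v ∈ {w : E3 n | 3 * δ / 2 ≤ max (dist w.1 w.2.1) (dist w.1 w.2.2)}
    · rw [Set.indicator_of_mem hv]; simp
    · rw [Set.indicator_of_notMem hv]; simp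
  have := norm_integral_le_of_norm_le (hI2.const_mul ((δ / 4) ^ (3 * n))⁻¹)
    (Filter.Eventually.of_forall hle)
  rw [hval] at this
  exact this

theorem psi_zero {n : ℕ} (φ : E3 n → ℝ) (hφ : GoodPhi φ) (δ : ℝ) (hδ : 0 < δ)
    (x y1 y2 : Rn n) (h1 : dist x y1 < δ) (h2 : dist x y2 < δ) :
    psiDelta φ δ (x, y1, y2) = 0 := by
  obtain ⟨hsm, hcs, hpos, hsupp, hint⟩ := hφ
  unfold psiDelta
  refine integral_eq_zero_of_ae (Filter.Eventually.of_forall ?_)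
  rintro ⟨v, w1, w2⟩
  simp only [Pi.zero_apply, mul_eq_zero]
  by_contra hcon
  push Not at hcon
  obtain ⟨⟨_, hp⟩, hi⟩ := hcon
  have hm := hsupp (subset_tsupport _ (Function.mem_support.2 hp))
  have hi := Set.mem_of_indicator_ne_zero hi
  simp only [Set.mem_setOf_eq, max_lt_iff, Prod.mk_sub_mk, Prod.smul_mk, norm_smul, le_max_iff]
    at hm hi
  obtain ⟨ha, hb, hc⟩ := hm
  have key : ∀ t : Rn n, ‖(4 / δ : ℝ)‖ * ‖t‖ < 1 → ‖t‖ < δ / 4 := by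
    intro t ht
    rw [Real.norm_of_nonneg (by positivity)] at ht
    have := mul_lt_mul_of_pos_left ht (show 0 < δ / 4 by positivity)
    rwa [← mul_assoc, show δ / 4 * (4 / δ) = 1 by field_simp, one_mul, mul_one] at this
  have ha := key _ ha
  have hb := key _ hb
  have hc := key _ hc
  rw [← dist_eq_norm] at ha hb hc
  rw [dist_comm] at ha
  rcases hi with hi | hi
  · have := dist_triangle4 v x y1 w1
    linarith
  · have := dist_triangle4 v x y2 w2
    linarith

theorem b_bounds {n : ℕ} (b : Rn n → ℝ) (hb : ContDiff ℝ (⊤ : ℕ∞) b) (hbc : HasCompactSupport b)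
    (β : ℝ) (hβ0 : 0 < β) (hβ1 : β < 1) :
    ∃ L : ℝ, 0 < L ∧ ∀ x y, |b y - b x| ≤ L * dist x y ∧ |b y - b x| ≤ L * dist x y ^ β := by
  obtain ⟨C, hC⟩ := hb.lipschitzWith_of_hasCompactSupport hbc (by simp)
  obtain ⟨M, hM⟩ := hbc.exists_bound_of_continuous hb.continuous
  have hM0 : 0 ≤ M := (norm_nonneg _).trans (hM 0)
  have hC0 : (0:ℝ) ≤ C := C.2
  refine ⟨C + 2 * M + 1, by positivity, fun x y => ?_⟩
  have hl : |b y - b x| ≤ C * dist x y := by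
    have := hC.dist_le_mul y x
    rwa [Real.dist_eq, dist_comm y x] at this
  have hd : 0 ≤ dist x y := dist_nonneg
  have h2 : |b y - b x| ≤ 2 * M := by
    have h3 := hM x
    have h4 := hM y
    have := norm_sub_le (b y) (b x)
    rw [Real.norm_eq_abs] at this
    linarith
  refine ⟨by nlinarith, ?_⟩
  have hp : 0 ≤ dist x y ^ β := Real.rpow_nonneg hd _
  rcases le_total (dist x y) 1 with h | h
  · have : dist x y ≤ dist x y ^ β := by
      simpa using Real.rpow_le_rpow_of_exponent_ge' hd h hβ0.le hβ1.le
    nlinarith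
  · have : 1 ≤ dist x y ^ β := Real.one_le_rpow h hβ0.le
    nlinarith

theorem cube_meas {n : ℕ} (Q : Cube n) : MeasurableSet Q.toSet := by
  unfold Cube.toSet
  apply IsClosed.measurableSet
  simp only [Set.setOf_forall]
  refine isClosed_iInter fun i => isClosed_le ?_ continuous_const
  fun_prop

theorem mem_cube {n : ℕ} (Q : Cube n) (y : Rn n) (h : dist Q.center y ≤ Q.side / 2) :
    y ∈ Q.toSet := by
  intro i
  have := PiLp.norm_apply_le (y - Q.center) i
  rw [← dist_eq_norm, dist_comm] at this
  simpa using this.trans h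

/-- The localized absolute value of `f`. -/
noncomputable def locAbs {n : ℕ} (Q : Cube n) (f : Rn n → ℝ) : Rn n → ℝ≥0∞ :=
  Q.toSet.indicator (fun y => ENNReal.ofReal |f y|)

theorem locAbs_meas {n : ℕ} (Q : Cube n) (f : Rn n → ℝ) (hf : Measurable f) :
    Measurable (locAbs Q f) :=
  Measurable.indicator (by fun_prop) (cube_meas Q)

theorem locAbs_int {n : ℕ} (Q : Cube n) (f : Rn n → ℝ) :
    ∫⁻ y, locAbs Q f y = ENNReal.ofReal Q.vol * avgE Q f := by
  unfold locAbs avgE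
  rw [lintegral_indicator (cube_meas Q), ← mul_assoc, ENNReal.mul_inv_cancel, one_mul]
  · have : 0 < Q.vol := pow_pos Q.side_pos _
    simpa using this
  · simp

theorem prod_int {n : ℕ} (Q R : Cube n) (f g : Rn n → ℝ) (hf : Measurable f) (hg : Measurable g) :
    ∫⁻ z : Rn n × Rn n, locAbs Q f z.1 * locAbs R g z.2 =
      ENNReal.ofReal (Q.vol * R.vol) * (avgE Q f * avgE R g) := by
  have h := lintegral_prod_mul (μ := (volume : Measure (Rn n))) (ν := (volume : Measure (Rn n)))
    (locAbs_meas Q f hf).aemeasurable (locAbs_meas R g hg).aemeasurable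
  rw [← Measure.volume_eq_prod] at h
  rw [h, locAbs_int, locAbs_int, ENNReal.ofReal_mul (show 0 ≤ Q.vol from (pow_pos Q.side_pos _).le)]
  ring

theorem sum_int {n : ℕ} (c : ℕ → ℝ≥0∞) (Q R : ℕ → Cube n) (f g : Rn n → ℝ) (hf : Measurable f)
    (hg : Measurable g) :
    ∫⁻ z : Rn n × Rn n, ∑' k, c k * (locAbs (Q k) f z.1 * locAbs (R k) g z.2) =
      ∑' k, c k * (ENNReal.ofReal ((Q k).vol * (R k).vol) * (avgE (Q k) f * avgE (R k) g)) := by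
  have hm : ∀ k, Measurable fun z : Rn n × Rn n => locAbs (Q k) f z.1 * locAbs (R k) g z.2 :=
    fun k => ((locAbs_meas _ f hf).comp measurable_fst).mul
      ((locAbs_meas _ g hg).comp measurable_snd)
  rw [lintegral_tsum fun k => ((hm k).const_mul _).aemeasurable]
  congr 1
  ext k
  rw [lintegral_const_mul _ (hm k), prod_int _ _ _ _ hf hg]

theorem term_bound {n : ℕ} (A η : ℝ) (hA : 0 < A) (hη : 0 < η) (r s : ℝ) (hr : 0 ≤ r) (k : ℕ)
    (hk : 2 ^ k * η ≤ s) : A / (r + s) ^ (2 * (n:ℝ)) ≤ A / (2 ^ k * η) ^ (2 * n) := by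
  have : (2 * (n:ℝ)) = ((2 * n : ℕ) : ℝ) := by push_cast; ring
  rw [this, Real.rpow_natCast]
  apply div_le_div_of_nonneg_left hA.le (by positivity)
  gcongr
  linarith

theorem coef {n : ℕ} (A η T : ℝ) (hη : 0 < η) (k : ℕ) :
    A / (2 ^ k * η) ^ (2 * n) * T * ((2 * η) ^ n * (2 ^ (k + 1) * (2 * η)) ^ n) =
      A * 2 ^ (4 * n) * (T * (2:ℝ) ^ (-(((k:ℝ) + 1) * n))) := by
  have : (2:ℝ) ^ (-(((k:ℝ) + 1) * n)) = (2 ^ ((k + 1) * n))⁻¹ := by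
    rw [Real.rpow_neg (by norm_num)]
    congr 1
    rw [← Real.rpow_natCast]; push_cast; rfl
  rw [this]
  have e : (2:ℝ) ^ (k * n) ≠ 0 := by positivity
  have e2 : η ^ n ≠ 0 := by positivity
  simp only [mul_pow, ← pow_mul, add_mul, pow_add, one_mul]
  rw [show k * (2 * n) = k * n + k * n by ring, show 2 * n = n + n by ring,
    show 4 * n = n + n + n + n by ring]
  simp only [pow_add]
  field_simp

theorem kd_bound {n : ℕ} (K : Rn n → Rn n → Rn n → ℝ) (A : ℝ) (hsize : SizeCond K A)
    (φ : E3 n → ℝ) (hφ : GoodPhi φ) (δ : ℝ) (hδ : 0 < δ) (x y1 y2 : Rn n)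
    (h : δ ≤ dist x y1 ∨ δ ≤ dist x y2) :
    |Kdelta φ δ K x y1 y2| ≤ A / (dist x y1 + dist x y2) ^ (2 * (n : ℝ)) := by
  have hne : x ≠ y1 ∨ x ≠ y2 := by
    rcases h with h | h
    · left; exact dist_pos.1 (hδ.trans_le h)
    · right; exact dist_pos.1 (hδ.trans_le h)
  unfold Kdelta
  rw [abs_mul]
  exact (mul_le_of_le_one_left (abs_nonneg _) (psi_bound φ hφ δ hδ _)).trans (hsize x y1 y2 hne)

theorem dyadic (η r : ℝ) (hη : 0 < η) (hr : η ≤ r) :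
    ∃ k : ℕ, 2 ^ k * η ≤ r ∧ r ≤ 2 ^ (k + 1) * η := by
  obtain ⟨k, h1, h2⟩ := exists_nat_pow_near (x := r / η) (y := (2:ℝ))
    ((one_le_div hη).2 hr) (by norm_num)
  exact ⟨k, (le_div_iff₀ hη).1 h1, ((div_lt_iff₀ hη).1 h2).le⟩

/-- The cube centered at `x` with side `2η`. -/
def baseCube {n : ℕ} (x : Rn n) (η : ℝ) (hη : 0 < η) : Cube n := ⟨x, 2 * η, by positivity⟩

theorem mem_base {n : ℕ} (x y : Rn n) (η : ℝ) (hη : 0 < η) (h : dist x y ≤ η) :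
    y ∈ (baseCube x η hη).toSet := by
  apply mem_cube
  simp only [baseCube]; linarith

theorem mem_base_dil {n : ℕ} (x y : Rn n) (η : ℝ) (hη : 0 < η) (k : ℕ)
    (h : dist x y ≤ 2 ^ k * η) : y ∈ ((baseCube x η hη).dilate k).toSet := by
  apply mem_cube
  simp only [baseCube, Cube.dilate]; linarith

theorem pointwise {n : ℕ} (K : Rn n → Rn n → Rn n → ℝ) (A : ℝ) (hA : 0 < A)
    (hsize : SizeCond K A) (φ : E3 n → ℝ) (hφ : GoodPhi φ) (b : Rn n → ℝ) (β L : ℝ)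
    (hβ0 : 0 < β) (hL : 0 < L)
    (hb : ∀ x y, |b y - b x| ≤ L * dist x y ∧ |b y - b x| ≤ L * dist x y ^ β)
    (δ : ℝ) (hδ : 0 < δ) (η : ℝ) (hη : 0 < η) (hηδ : η < δ) (f1 f2 : Rn n → ℝ) (x : Rn n)
    (z : Rn n × Rn n) :
    ‖Set.indicator {z : Rn n × Rn n | min (dist x z.1) (dist x z.2) < η}
      (fun z => Kdelta φ δ K x z.1 z.2 * (b z.1 - b x) * f1 z.1 * f2 z.2) z‖ₑ ≤
    (∑' k : ℕ, ENNReal.ofReal (A / (2 ^ k * η) ^ (2 * n) * (L * η)) *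
      (locAbs (baseCube x η hη) f1 z.1 *
        locAbs ((baseCube x η hη).dilate (k + 1)) f2 z.2)) +
    (∑' k : ℕ, ENNReal.ofReal (A / (2 ^ k * η) ^ (2 * n) * (L * (2 ^ (k + 1) * η) ^ β)) *
      (locAbs ((baseCube x η hη).dilate (k + 1)) f1 z.1 *
        locAbs (baseCube x η hη) f2 z.2)) := by
  by_cases hz : z ∈ {z : Rn n × Rn n | min (dist x z.1) (dist x z.2) < η}
  swap
  · rw [Set.indicator_of_notMem hz]; simp
  rw [Set.indicator_of_mem hz]
  obtain ⟨y1, y2⟩ := z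
  simp only [Set.mem_setOf_eq, min_lt_iff] at hz
  dsimp only
  by_cases hK : dist x y1 < δ ∧ dist x y2 < δ
  · simp [Kdelta, psi_zero φ hφ δ hδ x y1 y2 hK.1 hK.2]
  have hK' : δ ≤ dist x y1 ∨ δ ≤ dist x y2 := by
    by_contra hcon
    push Not at hcon
    exact hK hcon
  have hkd := kd_bound K A hsize φ hφ δ hδ x y1 y2 hK'
  have key : ∀ c : ℝ, 0 ≤ c → |Kdelta φ δ K x y1 y2| * |b y1 - b x| ≤ c →
      ‖Kdelta φ δ K x y1 y2 * (b y1 - b x) * f1 y1 * f2 y2‖ₑ ≤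
        ENNReal.ofReal c * (ENNReal.ofReal |f1 y1| * ENNReal.ofReal |f2 y2|) := by
    intro c hc h
    rw [← ofReal_norm_eq_enorm, ← ENNReal.ofReal_mul (abs_nonneg _), ← ENNReal.ofReal_mul hc]
    apply ENNReal.ofReal_le_ofReal
    simp only [norm_mul, Real.norm_eq_abs]
    rw [mul_assoc]
    exact mul_le_mul_of_nonneg_right h (by positivity)
  rcases hz with hz | hz
  · -- `y1` is close to `x`
    have h2 : δ ≤ dist x y2 := hK'.resolve_left (by linarith)
    obtain ⟨k, hk1, hk2⟩ := dyadic η (dist x y2) hη (by linarith)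
    refine le_trans ?_ le_self_add
    refine le_trans ?_ (ENNReal.le_tsum k)
    rw [locAbs, locAbs, Set.indicator_of_mem (mem_base x y1 η hη hz.le),
      Set.indicator_of_mem (mem_base_dil x y2 η hη (k + 1) hk2)]
    apply key _ (by positivity)
    have := term_bound (n := n) A η hA hη (dist x y1) _ dist_nonneg k hk1
    refine mul_le_mul (hkd.trans this) ((hb x y1).1.trans ?_) (abs_nonneg _) (by positivity)
    gcongr
  · have h2 : δ ≤ dist x y1 := hK'.resolve_right (by linarith)
    obtain ⟨k, hk1, hk2⟩ := dyadic η (dist x y1) hη (by linarith)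
    refine le_trans ?_ le_add_self
    refine le_trans ?_ (ENNReal.le_tsum k)
    rw [locAbs, locAbs, Set.indicator_of_mem (mem_base x y2 η hη hz.le),
      Set.indicator_of_mem (mem_base_dil x y1 η hη (k + 1) hk2)]
    apply key _ (by positivity)
    have := term_bound (n := n) A η hA hη (dist x y2) _ dist_nonneg k hk1
    rw [add_comm] at this
    refine mul_le_mul (hkd.trans this) ((hb x y1).2.trans ?_) (abs_nonneg _) (by positivity)
    gcongr

/-- the estimate for the term `C(x)` in the proof of Theorem 1. -/
theorem stmt19 {n : ℕ} (hn : 0 < n)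
    (K : Rn n → Rn n → Rn n → ℝ) (A0 : ℝ) (hA0 : 0 < A0) (hsize : SizeCond K A0)
    (φ : E3 n → ℝ) (hφ : GoodPhi φ)
    (b : Rn n → ℝ) (hb : ContDiff ℝ (⊤ : ℕ∞) b) (hbc : HasCompactSupport b)
    (β : ℝ) (hβ0 : 0 < β) (hβ1 : β < 1) :
    ∃ C : ℝ, 0 < C ∧ ∀ δ : ℝ, 0 < δ → ∀ η : ℝ, 0 < η → η < δ →
      ∀ f1 f2 : Rn n → ℝ, BCS f1 → BCS f2 → ∀ x : Rn n,
        ENNReal.ofReal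
            |∫ z : Rn n × Rn n,
              Set.indicator {z : Rn n × Rn n | min (dist x z.1) (dist x z.2) < η}
                (fun z => Kdelta φ δ K x z.1 z.2 * (b z.1 - b x) *
                  f1 z.1 * f2 z.2) z| ≤
          ENNReal.ofReal C *
            (ENNReal.ofReal η * M21 f1 f2 x +
              ENNReal.ofReal (η ^ β) * M2beta β f1 f2 x) := by
  obtain ⟨L, hL, hbL⟩ := b_bounds b hb hbc β hβ0 hβ1
  refine ⟨A0 * 2 ^ (4 * n) * L, by positivity, ?_⟩
  intro δ hδ η hη hηδ f1 f2 hf1 hf2 x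
  have hmem : x ∈ (baseCube x η hη).toSet := mem_base x x η hη (by simpa using hη.le)
  rw [← Real.norm_eq_abs, ofReal_norm_eq_enorm]
  refine (enorm_integral_le_lintegral_enorm _).trans ?_
  refine (lintegral_mono (pointwise K A0 hA0 hsize φ hφ b β L hβ0 hL hbL δ hδ η hη hηδ
    f1 f2 x)).trans ?_
  set Q := baseCube x η hη with hQ
  have hm : ∀ k, Measurable fun z : Rn n × Rn n => locAbs Q f1 z.1 *
      locAbs (Q.dilate (k + 1)) f2 z.2 :=
    fun k => ((locAbs_meas _ f1 hf1.1).comp measurable_fst).mul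
      ((locAbs_meas _ f2 hf2.1).comp measurable_snd)
  rw [lintegral_add_left (Measurable.ennreal_tsum fun k => (hm k).const_mul _),
    sum_int _ (fun _ => Q) (fun k => Q.dilate (k + 1)) f1 f2 hf1.1 hf2.1,
    sum_int _ (fun k => Q.dilate (k + 1)) (fun _ => Q) f1 f2 hf1.1 hf2.1, mul_add]
  have hv : Q.vol = (2 * η) ^ n := rfl
  have hvk : ∀ k, (Q.dilate k).vol = (2 ^ k * (2 * η)) ^ n := fun _ => rfl
  refine add_le_add ?_ ?_
  · rw [← mul_assoc, ← ENNReal.ofReal_mul (by positivity)]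
    have h1 : (∑' k : ℕ, ENNReal.ofReal ((2:ℝ) ^ (-((k : ℝ) * n))) * avgE Q f1 *
        avgE (Q.dilate k) f2) ≤ M21 f1 f2 x := by
      unfold M21
      exact le_iSup₂_of_le Q hmem le_rfl
    refine le_trans ?_ (mul_le_mul_right h1 _)
    refine le_trans ?_ (mul_le_mul_right (ENNReal.tsum_comp_le_tsum_of_injective
      (add_left_injective 1) _) _)
    rw [← ENNReal.tsum_mul_left]
    refine ENNReal.tsum_le_tsum fun k => le_of_eq ?_
    rw [hv, hvk, ← mul_assoc, ← ENNReal.ofReal_mul (by positivity), coef A0 η _ hη k]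
    rw [← mul_assoc (A0 * 2 ^ (4 * n)), ← mul_assoc (A0 * 2 ^ (4 * n)),
      ENNReal.ofReal_mul (by positivity)]
    push_cast
    ring
  · rw [← mul_assoc, ← ENNReal.ofReal_mul (by positivity)]
    have h1 : (avgE Q f2 * ∑' k : ℕ,
      ENNReal.ofReal ((2:ℝ) ^ (((k : ℝ) + 1) * (β - n))) * avgE (Q.dilate (k + 1)) f1)
        ≤ M2beta β f1 f2 x := by
      unfold M2beta
      exact le_iSup₂_of_le Q hmem le_rfl
    refine le_trans ?_ (mul_le_mul_right h1 _)
    rw [← ENNReal.tsum_mul_left, ← ENNReal.tsum_mul_left]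
    refine ENNReal.tsum_le_tsum fun k => le_of_eq ?_
    rw [hv, hvk, ← mul_assoc, ← ENNReal.ofReal_mul (by positivity),
      mul_comm ((2 ^ (k + 1) * (2 * η)) ^ n), coef A0 η _ hη k]
    have e : A0 * 2 ^ (4 * n) * (L * (2 ^ (k + 1) * η) ^ β * (2:ℝ) ^ (-(((k:ℝ) + 1) * n))) =
        A0 * 2 ^ (4 * n) * L * η ^ β * (2:ℝ) ^ (((k : ℝ) + 1) * (β - n)) := by
      rw [Real.mul_rpow (by positivity) hη.le, mul_sub, sub_eq_add_neg,
        Real.rpow_add (by norm_num), Real.rpow_mul (by norm_num) _ β]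
      rw [show ((k:ℝ) + 1) = ((k + 1 : ℕ) : ℝ) by push_cast; ring, Real.rpow_natCast]
      ring
    rw [e, ENNReal.ofReal_mul (by positivity)]
    ring
end
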